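/- Let x_L < 0 < x_R, let h⁻, u⁻ solve the linearized Serre equations on [x_L, 0] × [0, ∞) and h⁺, u⁺ solve them on [0, x_R] × [0, ∞), with energies E⁻(t) and E⁺(t). Assume the interface conditions hold for all t ≥ 0: h⁻(0,t) = h⁺(0,t), u⁻(0,t) = u⁺(0,t), ∂u⁻/∂x(0,t) = ∂u⁺/∂x(0,t), ∂²u⁻/∂x²(0,t) = ∂²u⁺/∂x²(0,t) (so that, by smoothness, also ∂²u⁻/(∂x∂t)(0,t) = ∂²u⁺/(∂x∂t)(0,t)). Assume further that the contributions from the outer boundaries cancel: BT(h⁺,u⁺)(x_R,t) = BT(h⁻,u⁻)(x_L,t) for all t ≥ 0. Then the total energy is conserved: E⁻(t) + E⁺(t) = E⁻(0) + E⁺(0) for all t ≥ 0. -/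

import Mathlib

open Real MeasureTheory Set

noncomputable section

/-- Partial derivative in the spatial variable `x` (first argument). -/
def pdX (f : ℝ → ℝ → ℝ) (x t : ℝ) : ℝ := deriv (fun ξ => f ξ t) x

/-- Partial derivative in the temporal variable `t` (second argument). -/
def pdT (f : ℝ → ℝ → ℝ) (x t : ℝ) : ℝ := deriv (fun τ => f x τ) t

/-- `h, u` solve the linearized Serre equations on `[xL, xR] × [0, ∞)`:
they are sufficiently smooth and satisfy the continuity and momentum equations. -/
def SolvesSerre (g H U xL xR : ℝ) (h u : ℝ → ℝ → ℝ) : Prop :=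
  ContDiff ℝ 3 (fun p : ℝ × ℝ => h p.1 p.2) ∧
  ContDiff ℝ 3 (fun p : ℝ × ℝ => u p.1 p.2) ∧
  (∀ x ∈ Set.Icc xL xR, ∀ t : ℝ, 0 ≤ t →
    pdT h x t + pdX (fun ξ τ => H * u ξ τ + U * h ξ τ) x t = 0) ∧
  (∀ x ∈ Set.Icc xL xR, ∀ t : ℝ, 0 ≤ t →
    pdT u x t + pdX (fun ξ τ => g * h ξ τ + U * u ξ τ
      - H ^ 2 * U / 3 * pdX (pdX u) ξ τ
      - H ^ 2 / 3 * pdT (pdX u) ξ τ) x t = 0)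

/-- The energy `E(t)` on the interval `[xL, xR]`. -/
def energy (g H xL xR : ℝ) (h u : ℝ → ℝ → ℝ) (t : ℝ) : ℝ :=
  g / 2 * (∫ x in xL..xR, h x t ^ 2)
    + H / 2 * (∫ x in xL..xR, u x t ^ 2)
    + H ^ 3 / 6 * (∫ x in xL..xR, pdX u x t ^ 2)

/-- The boundary term `BT(h, u)(x, t)`. -/
def BT (g H U : ℝ) (h u : ℝ → ℝ → ℝ) (x t : ℝ) : ℝ :=
  -(g * H) * h x t * u x t - g * U / 2 * h x t ^ 2 - H * U / 2 * u x t ^ 2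
    - H ^ 3 * U / 6 * pdX u x t ^ 2
    + H ^ 3 * U / 3 * (u x t * pdX (pdX u) x t)
    + H ^ 3 / 3 * (u x t * pdT (pdX u) x t)

theorem hasDerivAt_slice_fst {f : ℝ → ℝ → ℝ} {p : ℝ × ℝ}
    (hf : DifferentiableAt ℝ (fun q : ℝ × ℝ => f q.1 q.2) p) :
    HasDerivAt (fun ξ => f ξ p.2) (fderiv ℝ (fun q : ℝ × ℝ => f q.1 q.2) p (1, 0)) p.1 :=
  hf.hasFDerivAt.comp_hasDerivAt (f := fun ξ : ℝ => (ξ, p.2)) p.1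
    ((hasDerivAt_id p.1).prodMk (hasDerivAt_const p.1 p.2))

theorem hasDerivAt_slice_snd {f : ℝ → ℝ → ℝ} {p : ℝ × ℝ}
    (hf : DifferentiableAt ℝ (fun q : ℝ × ℝ => f q.1 q.2) p) :
    HasDerivAt (fun τ => f p.1 τ) (fderiv ℝ (fun q : ℝ × ℝ => f q.1 q.2) p (0, 1)) p.2 :=
  hf.hasFDerivAt.comp_hasDerivAt (f := fun τ : ℝ => (p.1, τ)) p.2
    ((hasDerivAt_const p.2 p.1).prodMk (hasDerivAt_id p.2))

theorem hasDerivAt_pdX {f : ℝ → ℝ → ℝ} (hf : ContDiff ℝ 1 (fun p : ℝ × ℝ => f p.1 p.2))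
    (x t : ℝ) : HasDerivAt (fun ξ => f ξ t) (pdX f x t) x :=
  (hasDerivAt_slice_fst (p := (x, t))
    (hf.differentiable one_ne_zero _)).differentiableAt.hasDerivAt

theorem hasDerivAt_pdT {f : ℝ → ℝ → ℝ} (hf : ContDiff ℝ 1 (fun p : ℝ × ℝ => f p.1 p.2))
    (x t : ℝ) : HasDerivAt (fun τ => f x τ) (pdT f x t) t :=
  (hasDerivAt_slice_snd (p := (x, t))
    (hf.differentiable one_ne_zero _)).differentiableAt.hasDerivAt

theorem contDiff_pdX {f : ℝ → ℝ → ℝ} {m n : WithTop ℕ∞}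
    (hf : ContDiff ℝ n (fun p : ℝ × ℝ => f p.1 p.2)) (hmn : m + 1 ≤ n) :
    ContDiff ℝ m (fun p : ℝ × ℝ => pdX f p.1 p.2) := by
  have hd : Differentiable ℝ (fun p : ℝ × ℝ => f p.1 p.2) :=
    (hf.of_le (le_add_self.trans hmn)).differentiable one_ne_zero
  have heq : (fun p : ℝ × ℝ => pdX f p.1 p.2) =
      fun p => fderiv ℝ (fun q : ℝ × ℝ => f q.1 q.2) p (1, 0) :=
    funext fun p => (hasDerivAt_slice_fst (hd p)).deriv
  rw [heq]
  exact (hf.fderiv_right hmn).clm_apply contDiff_const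

theorem contDiff_pdT {f : ℝ → ℝ → ℝ} {m n : WithTop ℕ∞}
    (hf : ContDiff ℝ n (fun p : ℝ × ℝ => f p.1 p.2)) (hmn : m + 1 ≤ n) :
    ContDiff ℝ m (fun p : ℝ × ℝ => pdT f p.1 p.2) := by
  have hd : Differentiable ℝ (fun p : ℝ × ℝ => f p.1 p.2) :=
    (hf.of_le (le_add_self.trans hmn)).differentiable one_ne_zero
  have heq : (fun p : ℝ × ℝ => pdT f p.1 p.2) =
      fun p => fderiv ℝ (fun q : ℝ × ℝ => f q.1 q.2) p (0, 1) :=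
    funext fun p => (hasDerivAt_slice_snd (hd p)).deriv
  rw [heq]
  exact (hf.fderiv_right hmn).clm_apply contDiff_const

/-- Differentiation under the integral sign for a jointly `C¹` integrand. -/
theorem hasDerivAt_integral_pdT {f : ℝ → ℝ → ℝ}
    (hf : ContDiff ℝ 1 (fun p : ℝ × ℝ => f p.1 p.2)) (a b t : ℝ) :
    HasDerivAt (fun τ => ∫ x in a..b, f x τ) (∫ x in a..b, pdT f x t) t := by
  have hcT : Continuous (fun p : ℝ × ℝ => pdT f p.1 p.2) :=
    (contDiff_pdT (m := 0) hf (by simp)).continuous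
  obtain ⟨C, hC⟩ := (isCompact_uIcc (a := a) (b := b)).prod
    (isCompact_Icc (a := t - 1) (b := t + 1)) |>.exists_bound_of_continuousOn hcT.continuousOn
  have hslice {F : ℝ × ℝ → ℝ} (hF : Continuous F) (τ : ℝ) : Continuous fun x => F (x, τ) :=
    hF.comp (by fun_prop)
  refine (intervalIntegral.hasDerivAt_integral_of_dominated_loc_of_deriv_le
    (F := fun τ x => f x τ) (F' := fun τ x => pdT f x τ) (bound := fun _ => C)
    (Icc_mem_nhds (sub_one_lt t) (lt_add_one t))
    (.of_forall fun τ => (hslice hf.continuous τ).aestronglyMeasurable)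
    ((hslice hf.continuous t).intervalIntegrable a b)
    (hslice hcT t).aestronglyMeasurable
    (.of_forall fun x hx τ hτ => hC (x, τ) ⟨uIoc_subset_uIcc hx, hτ⟩)
    intervalIntegrable_const
    (.of_forall fun x _ τ _ => hasDerivAt_pdT hf x τ)).2

theorem hasDerivAt_integral_sq {f : ℝ → ℝ → ℝ}
    (hf : ContDiff ℝ 1 (fun p : ℝ × ℝ => f p.1 p.2)) (a b t : ℝ) :
    HasDerivAt (fun τ => ∫ x in a..b, f x τ ^ 2) (∫ x in a..b, 2 * f x t * pdT f x t) t := by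
  have hsq : ∀ x, pdT (fun ξ τ => f ξ τ ^ 2) x t = 2 * f x t * pdT f x t := fun x =>
    ((hasDerivAt_pdT hf x t).pow 2).deriv.trans (by simp)
  simpa only [hsq] using hasDerivAt_integral_pdT (f := fun ξ τ => f ξ τ ^ 2) (hf.pow 2) a b t

/-- The rate of change of the energy is the difference of the boundary terms. -/
theorem SolvesSerre.hasDerivAt_energy {g H U a b : ℝ} {h u : ℝ → ℝ → ℝ} (hab : a ≤ b)
    (hs : SolvesSerre g H U a b h u) {t : ℝ} (ht : 0 ≤ t) :
    HasDerivAt (energy g H a b h u) (BT g H U h u b t - BT g H U h u a t) t := by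
  obtain ⟨hh, hu, hmass, hmom⟩ := hs
  have h1 : ContDiff ℝ 1 (fun p : ℝ × ℝ => h p.1 p.2) := hh.of_le (by norm_num)
  have u1 : ContDiff ℝ 1 (fun p : ℝ × ℝ => u p.1 p.2) := hu.of_le (by norm_num)
  have ux2 : ContDiff ℝ 2 (fun p : ℝ × ℝ => pdX u p.1 p.2) := contDiff_pdX hu (by norm_num)
  have ux1 : ContDiff ℝ 1 (fun p : ℝ × ℝ => pdX u p.1 p.2) := ux2.of_le (by norm_num)
  have uxx1 : ContDiff ℝ 1 (fun p : ℝ × ℝ => pdX (pdX u) p.1 p.2) :=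
    contDiff_pdX ux2 (by norm_num)
  have uxt1 : ContDiff ℝ 1 (fun p : ℝ × ℝ => pdT (pdX u) p.1 p.2) :=
    contDiff_pdT ux2 (by norm_num)
  have hcont {f : ℝ → ℝ → ℝ} (hf : ContDiff ℝ 1 (fun p : ℝ × ℝ => f p.1 p.2)) :
      Continuous fun x => f x t := hf.continuous.comp (by fun_prop : Continuous fun x => (x, t))
  have hcontT {f : ℝ → ℝ → ℝ} (hf : ContDiff ℝ 1 (fun p : ℝ × ℝ => f p.1 p.2)) :
      Continuous fun x => pdT f x t :=
    (contDiff_pdT (m := 0) hf (by simp)).continuous.comp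
      (by fun_prop : Continuous fun x => (x, t))
  have hI {f : ℝ → ℝ → ℝ} (hf : ContDiff ℝ 1 (fun p : ℝ × ℝ => f p.1 p.2)) (c : ℝ) :
      IntervalIntegrable (fun x => c * (2 * f x t * pdT f x t)) volume a b :=
    (((continuous_const.mul (hcont hf)).mul (hcontT hf)).const_mul c).intervalIntegrable a b
  have hderiv : ∀ x ∈ uIcc a b, HasDerivAt (fun ξ => BT g H U h u ξ t)
      (g / 2 * (2 * h x t * pdT h x t) + H / 2 * (2 * u x t * pdT u x t)
        + H ^ 3 / 6 * (2 * pdX u x t * pdT (pdX u) x t)) x := by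
    intro x hx
    rw [uIcc_of_le hab] at hx
    have dh := hasDerivAt_pdX h1 x t
    have du := hasDerivAt_pdX u1 x t
    have dux := hasDerivAt_pdX ux1 x t
    have duxx := hasDerivAt_pdX uxx1 x t
    have duxt := hasDerivAt_pdX uxt1 x t
    have emass := hmass x hx t ht
    have emom := hmom x hx t ht
    have e1 : pdX (fun ξ τ => H * u ξ τ + U * h ξ τ) x t = H * pdX u x t + U * pdX h x t :=
      ((du.const_mul H).add (dh.const_mul U)).deriv
    have e2 : pdX (fun ξ τ => g * h ξ τ + U * u ξ τ - H ^ 2 * U / 3 * pdX (pdX u) ξ τ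
        - H ^ 2 / 3 * pdT (pdX u) ξ τ) x t = g * pdX h x t + U * pdX u x t
        - H ^ 2 * U / 3 * pdX (pdX (pdX u)) x t - H ^ 2 / 3 * pdX (pdT (pdX u)) x t :=
      ((((dh.const_mul g).add (du.const_mul U)).sub (duxx.const_mul (H ^ 2 * U / 3))).sub
        (duxt.const_mul (H ^ 2 / 3))).deriv
    rw [e1] at emass
    rw [e2] at emom
    have key := ((((((dh.const_mul (-(g * H))).mul du).sub
      ((dh.pow 2).const_mul (g * U / 2))).sub ((du.pow 2).const_mul (H * U / 2))).sub
      ((dux.pow 2).const_mul (H ^ 3 * U / 6))).add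
      ((du.mul duxx).const_mul (H ^ 3 * U / 3))).add ((du.mul duxt).const_mul (H ^ 3 / 3))
    refine key.congr_deriv ?_
    norm_num
    linear_combination (-(g * h x t)) * emass - H * u x t * emom
  have hE := (((hasDerivAt_integral_sq h1 a b t).const_mul (g / 2)).add
    ((hasDerivAt_integral_sq u1 a b t).const_mul (H / 2))).add
    ((hasDerivAt_integral_sq ux1 a b t).const_mul (H ^ 3 / 6))
  refine hE.congr_deriv ?_
  rw [← intervalIntegral.integral_eq_sub_of_hasDerivAt hderiv
      (((hI h1 _).add (hI u1 _)).add (hI ux1 _)),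
    intervalIntegral.integral_add ((hI h1 _).add (hI u1 _)) (hI ux1 _),
    intervalIntegral.integral_add (hI h1 _) (hI u1 _)]
  simp only [intervalIntegral.integral_const_mul]

/-- Time derivatives at positive times agree for functions that agree at nonnegative times. -/
theorem pdT_eq_of_eq_of_nonneg {f₁ f₂ : ℝ → ℝ → ℝ} {x : ℝ}
    (hf : ∀ t : ℝ, 0 ≤ t → f₁ x t = f₂ x t) {t : ℝ} (ht : 0 < t) : pdT f₁ x t = pdT f₂ x t :=
  Filter.EventuallyEq.deriv_eq <| (eventually_gt_nhds ht).mono fun τ hτ => hf τ hτ.le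

/-- Theorem 3.10: with the interface conditions and cancelling outer boundary
terms, the total energy of the coupled problem is conserved. -/
theorem energy_conservation_interface (g H U xL xR : ℝ) (hg : 0 < g) (hH : 0 < H)
    (hxL : xL < 0) (hxR : 0 < xR) (hm um hp up : ℝ → ℝ → ℝ)
    (hsolm : SolvesSerre g H U xL 0 hm um) (hsolp : SolvesSerre g H U 0 xR hp up)
    (hint_h : ∀ t : ℝ, 0 ≤ t → hm 0 t = hp 0 t)
    (hint_u : ∀ t : ℝ, 0 ≤ t → um 0 t = up 0 t)
    (hint_ux : ∀ t : ℝ, 0 ≤ t → pdX um 0 t = pdX up 0 t)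
    (hint_uxx : ∀ t : ℝ, 0 ≤ t → pdX (pdX um) 0 t = pdX (pdX up) 0 t)
    (houter : ∀ t : ℝ, 0 ≤ t → BT g H U hp up xR t = BT g H U hm um xL t) :
    ∀ t : ℝ, 0 ≤ t →
      energy g H xL 0 hm um t + energy g H 0 xR hp up t
        = energy g H xL 0 hm um 0 + energy g H 0 xR hp up 0 := by
  intro t ht
  have hd : ∀ τ : ℝ, 0 ≤ τ → HasDerivAt
      (fun τ => energy g H xL 0 hm um τ + energy g H 0 xR hp up τ) _ τ := fun τ hτ =>
    (hsolm.hasDerivAt_energy hxL.le hτ).add (hsolp.hasDerivAt_energy hxR.le hτ)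
  rcases ht.eq_or_lt with rfl | hpos
  · rfl
  obtain ⟨c, hc, hslope⟩ := exists_hasDerivAt_eq_slope _ _ hpos
    (fun τ hτ => (hd τ hτ.1).continuousAt.continuousWithinAt) (fun τ hτ => hd τ hτ.1.le)
  have hBT : BT g H U hm um 0 c = BT g H U hp up 0 c := by
    simp only [BT, hint_h c hc.1.le, hint_u c hc.1.le, hint_ux c hc.1.le, hint_uxx c hc.1.le,
      pdT_eq_of_eq_of_nonneg hint_ux hc.1]
  rw [hBT, houter c hc.1.le, eq_div_iff (by linarith)] at hslope
  linarith
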